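/- arXiv:1702.07026 — 2 statements merged into one kernel-verified Lean document; each statement's English description precedes it below -/
import Mathlib

section
/- Let $C_\varepsilon = \frac{1}{\pi}\log \varepsilon^{-1}$. There exist constants $\mu_1, \mu_2 \in \mathbb{R}$ such that for every $t > 0$, $\nu_\varepsilon(t) - C_\varepsilon t \to t(\mu_1 + \mu_2 \log t)$ as $\varepsilon \to 0^+$. -/
open MeasureTheory ProbabilityTheory Real Filter Set

/-- The planar heat kernel `p_v(x) = (2πv)⁻¹ exp(-|x|²/(2v))`, with `|x|` the
Euclidean norm of `x ∈ ℝ²`. -/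
noncomputable def heatKernel (v : ℝ) (x : Fin 2 → ℝ) : ℝ :=
  (2 * π * v)⁻¹ * Real.exp (-(x 0 ^ 2 + x 1 ^ 2) / (2 * v))

/-- The rescaling `R_ε(x) = ε⁻² R(x/ε)` of a function `R : ℝ² → ℝ`. -/
noncomputable def mollify (R : (Fin 2 → ℝ) → ℝ) (ε : ℝ) (x : Fin 2 → ℝ) : ℝ :=
  (ε ^ 2)⁻¹ * R (ε⁻¹ • x)

/-- `ν_ε(t) = ∫_0^t ∫_0^s ∫_{ℝ²} R_ε(x) p_{s-u}(x) dx du ds`. -/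
noncomputable def nuReg (R : (Fin 2 → ℝ) → ℝ) (ε t : ℝ) : ℝ :=
  ∫ s in (0:ℝ)..t, ∫ u in (0:ℝ)..s, ∫ x : Fin 2 → ℝ, mollify R ε x * heatKernel (s - u) x


noncomputable def gfun (R : (Fin 2 → ℝ) → ℝ) (v : ℝ) : ℝ :=
  ∫ x : Fin 2 → ℝ, R x * heatKernel v x

noncomputable def gpos (R : (Fin 2 → ℝ) → ℝ) : ℝ → ℝ := (Set.Ioi (0:ℝ)).indicator (gfun R)

lemma heat_nonneg {v : ℝ} (hv : 0 < v) (x : Fin 2 → ℝ) : 0 ≤ heatKernel v x := by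
  unfold heatKernel; positivity

lemma heat_prod {v : ℝ} (x : Fin 2 → ℝ) :
    heatKernel v x = (2 * π * v)⁻¹ * ∏ i, Real.exp (-(1 / (2 * v)) * (x i) ^ 2) := by
  unfold heatKernel
  rw [Fin.prod_univ_two, ← Real.exp_add]
  congr 2
  ring

lemma heat_integrable {v : ℝ} (hv : 0 < v) : Integrable (heatKernel v) := by
  have : heatKernel v = fun x => (2 * π * v)⁻¹ * ∏ i, Real.exp (-(1 / (2 * v)) * (x i) ^ 2) := by
    funext x; exact heat_prod x
  rw [this]
  apply Integrable.const_mul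
  exact Integrable.fintype_prod (f := fun _ (y:ℝ) => Real.exp (-(1 / (2 * v)) * y ^ 2))
    (fun i => integrable_exp_neg_mul_sq (by positivity))

lemma heat_integral {v : ℝ} (hv : 0 < v) : ∫ x, heatKernel v x = 1 := by
  simp_rw [heat_prod]
  rw [integral_const_mul, integral_fintype_prod_volume_eq_prod
    (f := fun _ (y:ℝ) => Real.exp (-(1 / (2 * v)) * y ^ 2))]
  rw [Fin.prod_univ_two, integral_gaussian, Real.mul_self_sqrt (by positivity)]
  field_simp

lemma scale (R : (Fin 2 → ℝ) → ℝ) {ε : ℝ} (hε : 0 < ε) (v : ℝ) :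
    ∫ x : Fin 2 → ℝ, mollify R ε x * heatKernel v x = (ε ^ 2)⁻¹ * gfun R ((ε ^ 2)⁻¹ * v) := by
  have h1 : ∀ x : Fin 2 → ℝ, mollify R ε x * heatKernel v x =
      (ε ^ 2)⁻¹ * (ε ^ 2)⁻¹ * ((fun y => R y * heatKernel ((ε ^ 2)⁻¹ * v) y) (ε⁻¹ • x)) := by
    intro x
    have e : heatKernel ((ε ^ 2)⁻¹ * v) (ε⁻¹ • x) = ε ^ 2 * heatKernel v x := by
      unfold heatKernel
      simp only [Pi.smul_apply, smul_eq_mul]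
      have : -((ε⁻¹ * x 0) ^ 2 + (ε⁻¹ * x 1) ^ 2) / (2 * ((ε ^ 2)⁻¹ * v)) =
        -(x 0 ^ 2 + x 1 ^ 2) / (2 * v) := by
        rcases eq_or_ne v 0 with rfl | hv
        · simp
        · field_simp
      rw [this]
      rcases eq_or_ne v 0 with rfl | hv
      · simp
      · field_simp
    simp only [e, mollify]
    field_simp
  simp_rw [h1]
  rw [integral_const_mul, Measure.integral_comp_smul volume
    (fun y => R y * heatKernel ((ε ^ 2)⁻¹ * v) y) ε⁻¹]
  simp only [Module.finrank_fintype_fun_eq_card, Fintype.card_fin, smul_eq_mul, gfun]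
  rw [abs_of_pos (by positivity)]
  field_simp

lemma gfun_meas (R : (Fin 2 → ℝ) → ℝ) (hR : Continuous R) : Measurable (gfun R) := by
  have : StronglyMeasurable (Function.uncurry fun (v : ℝ) (x : Fin 2 → ℝ) => R x * heatKernel v x) := by
    apply Measurable.stronglyMeasurable
    have := hR.measurable
    unfold Function.uncurry heatKernel
    fun_prop
  exact this.integral_prod_right.measurable

lemma gpos_meas (R : (Fin 2 → ℝ) → ℝ) (hR : Continuous R) : Measurable (gpos R) :=
  (gfun_meas R hR).indicator measurableSet_Ioi

lemma gpos_bound (R : (Fin 2 → ℝ) → ℝ) (hR : Continuous R) (h0 : ∀ x, 0 ≤ R x)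
    (hs : HasCompactSupport R) : ∃ M : ℝ, 0 ≤ M ∧ ∀ v, 0 ≤ gpos R v ∧ gpos R v ≤ M := by
  obtain ⟨M, hM⟩ := hs.exists_bound_of_continuous hR
  have hM0 : 0 ≤ M := (norm_nonneg _).trans (hM 0)
  refine ⟨M, hM0, fun v => ?_⟩
  by_cases hv : 0 < v
  · rw [gpos, Set.indicator_of_mem (by exact hv)]
    refine ⟨integral_nonneg fun x => mul_nonneg (h0 x) (heat_nonneg hv x), ?_⟩
    calc gfun R v ≤ ∫ x, M * heatKernel v x := by
          apply integral_mono_of_nonneg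
          · exact .of_forall fun x => mul_nonneg (h0 x) (heat_nonneg hv x)
          · exact (heat_integrable hv).const_mul M
          · exact .of_forall fun x => mul_le_mul_of_nonneg_right
              ((le_abs_self _).trans (hM x)) (heat_nonneg hv x)
      _ = M := by rw [integral_const_mul, heat_integral hv, mul_one]
  · rw [gpos, Set.indicator_of_notMem (by exact hv)]
    exact ⟨le_rfl, hM0⟩

lemma gpos_asymp (R : (Fin 2 → ℝ) → ℝ) (hR : Continuous R) (h0 : ∀ x, 0 ≤ R x)
    (hs : HasCompactSupport R) (hint : ∫ x : Fin 2 → ℝ, R x = 1) :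
    ∃ K : ℝ, 0 ≤ K ∧ ∀ v, 0 < v → |gpos R v - (2 * π)⁻¹ * v⁻¹| ≤ K * (v ^ 2)⁻¹ := by
  have hRi : Integrable R := hR.integrable_of_hasCompactSupport hs
  have hq : Integrable (fun x : Fin 2 → ℝ => R x * (x 0 ^ 2 + x 1 ^ 2)) :=
    (hR.mul (by fun_prop)).integrable_of_hasCompactSupport hs.mul_right
  refine ⟨(4 * π)⁻¹ * ∫ x : Fin 2 → ℝ, R x * (x 0 ^ 2 + x 1 ^ 2), ?_, fun v hv => ?_⟩
  · exact mul_nonneg (by positivity) (integral_nonneg fun x => mul_nonneg (h0 x) (by positivity))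
  rw [gpos, Set.indicator_of_mem (by exact hv)]
  have hi : Integrable (fun x : Fin 2 → ℝ => R x * heatKernel v x) := by
    refine (hR.mul ?_).integrable_of_hasCompactSupport hs.mul_right
    unfold heatKernel; fun_prop
  have e : gfun R v - (2 * π)⁻¹ * v⁻¹ =
      ∫ x, (R x * heatKernel v x - (2 * π)⁻¹ * v⁻¹ * R x) := by
    rw [integral_sub hi (hRi.const_mul _), integral_const_mul, hint, mul_one]; rfl
  rw [e, ← Real.norm_eq_abs]
  calc _ ≤ ∫ x : Fin 2 → ℝ, ((4 * π)⁻¹ * (v ^ 2)⁻¹) * (R x * (x 0 ^ 2 + x 1 ^ 2)) := by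
        apply norm_integral_le_of_norm_le (hq.const_mul _)
        refine .of_forall fun x => ?_
        have hr : R x * heatKernel v x - (2 * π)⁻¹ * v⁻¹ * R x =
          -((2 * π * v)⁻¹ * R x * (1 - Real.exp (-(x 0 ^ 2 + x 1 ^ 2) / (2 * v)))) := by
          unfold heatKernel; rw [mul_inv (2 * π) v]; ring
        have h1 := Real.add_one_le_exp (-(x 0 ^ 2 + x 1 ^ 2) / (2 * v))
        have h2 : Real.exp (-(x 0 ^ 2 + x 1 ^ 2) / (2 * v)) ≤ 1 := by
          rw [Real.exp_le_one_iff]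
          exact div_nonpos_of_nonpos_of_nonneg (by nlinarith [sq_nonneg (x 0), sq_nonneg (x 1)]) (by positivity)
        have hc : 0 ≤ (2 * π * v)⁻¹ * R x := mul_nonneg (by positivity) (h0 x)
        rw [hr, norm_neg, Real.norm_eq_abs, abs_of_nonneg (mul_nonneg hc (by linarith))]
        calc _ ≤ (2 * π * v)⁻¹ * R x * ((x 0 ^ 2 + x 1 ^ 2) / (2 * v)) := by
              apply mul_le_mul_of_nonneg_left _ hc
              rw [neg_div] at h1 ⊢; linarith
          _ = _ := by field_simp; ring
    _ = _ := by rw [integral_const_mul]; ring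

lemma gpos_ii (R : (Fin 2 → ℝ) → ℝ) (hR : Continuous R) (h0 : ∀ x, 0 ≤ R x)
    (hs : HasCompactSupport R) (a b : ℝ) : IntervalIntegrable (gpos R) volume a b := by
  obtain ⟨M, hM0, hM⟩ := gpos_bound R hR h0 hs
  refine (intervalIntegrable_const (c := M)).mono_fun
    (gpos_meas R hR).aestronglyMeasurable (.of_forall fun v => ?_)
  change ‖gpos R v‖ ≤ ‖M‖
  rw [Real.norm_of_nonneg (hM v).1, Real.norm_of_nonneg hM0]
  exact (hM v).2

noncomputable def Gp (R : (Fin 2 → ℝ) → ℝ) (T : ℝ) : ℝ := ∫ v in (0:ℝ)..T, gpos R v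

lemma nu_eq (R : (Fin 2 → ℝ) → ℝ) {ε t : ℝ} (hε : 0 < ε) (ht : 0 < t) :
    nuReg R ε t = ∫ s in (0:ℝ)..t, Gp R ((ε ^ 2)⁻¹ * s) := by
  unfold nuReg
  apply intervalIntegral.integral_congr
  intro s hs
  rw [Set.uIcc_of_le ht.le] at hs
  simp_rw [scale R hε]
  have hc : 0 < (ε ^ 2)⁻¹ := by positivity
  have := intervalIntegral.integral_comp_sub_left
    (fun w => (ε ^ 2)⁻¹ * gfun R ((ε ^ 2)⁻¹ * w)) (a := 0) (b := s) s
  rw [this, sub_self, sub_zero, intervalIntegral.integral_const_mul,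
    intervalIntegral.mul_integral_comp_mul_left, mul_zero, Gp]
  apply intervalIntegral.integral_congr_ae
  refine .of_forall fun v hv => ?_
  rw [Set.uIoc_of_le (mul_nonneg hc.le hs.1)] at hv
  rw [gpos, Set.indicator_of_mem (by exact hv.1)]

lemma H_props (R : (Fin 2 → ℝ) → ℝ) (hR : Continuous R) (h0 : ∀ x, 0 ≤ R x)
    (hs : HasCompactSupport R) (hint : ∫ x : Fin 2 → ℝ, R x = 1) :
    ∃ c A : ℝ, Tendsto (fun T => Gp R T - (2 * π)⁻¹ * Real.log T) atTop (nhds c) ∧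
      (∀ T, 1 ≤ T → |Gp R T - (2 * π)⁻¹ * Real.log T| ≤ A) ∧
      (∀ T, 0 < T → T ≤ 1 → |Gp R T - (2 * π)⁻¹ * Real.log T| ≤ A + (2 * π)⁻¹ * |Real.log T|) := by
  obtain ⟨M, hM0, hM⟩ := gpos_bound R hR h0 hs
  obtain ⟨K, hK0, hK⟩ := gpos_asymp R hR h0 hs hint
  have hii := gpos_ii R hR h0 hs
  set d : ℝ → ℝ := fun v => gpos R v - (2 * π)⁻¹ * v⁻¹ with hd
  have hdi : IntegrableOn d (Set.Ioi 1) := by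
    have h2 : IntegrableOn (fun v : ℝ => K * (v ^ 2)⁻¹) (Set.Ioi 1) := by
      apply Integrable.const_mul
      have := integrableOn_Ioi_rpow_of_lt (a := -2) (by norm_num) (c := 1) one_pos
      refine this.congr_fun (fun v hv => ?_) measurableSet_Ioi
      have : (0:ℝ) < v := lt_trans one_pos hv
      simp only [Real.rpow_neg this.le]
      norm_cast
    refine Integrable.mono' h2 ?_ ?_
    · exact ((gpos_meas R hR).sub (by fun_prop)).aestronglyMeasurable
    · filter_upwards [ae_restrict_mem measurableSet_Ioi] with v hv
      exact hK v (lt_trans one_pos hv)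
  have key : ∀ T, 1 ≤ T → Gp R T - (2 * π)⁻¹ * Real.log T = Gp R 1 + ∫ v in (1:ℝ)..T, d v := by
    intro T hT
    have hinv : IntervalIntegrable (fun v : ℝ => v⁻¹) volume 1 T := by
      apply intervalIntegral.intervalIntegrable_inv
      · intro x hx; rw [Set.uIcc_of_le hT] at hx; have := hx.1; positivity
      · fun_prop
    rw [hd, intervalIntegral.integral_sub (hii _ _) (hinv.const_mul _),
      intervalIntegral.integral_const_mul, integral_inv_of_pos one_pos (by linarith), div_one]
    unfold Gp
    rw [← intervalIntegral.integral_add_adjacent_intervals (hii 0 1) (hii 1 T)]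
    ring
  have hG : ∀ T, 0 ≤ T → T ≤ 1 → |Gp R T| ≤ M := by
    intro T hT hT1
    have := intervalIntegral.norm_integral_le_of_norm_le_const (a := 0) (b := T) (f := gpos R) (C := M)
      (fun x _ => by rw [Real.norm_of_nonneg (hM x).1]; exact (hM x).2)
    rw [sub_zero, abs_of_nonneg hT] at this
    exact this.trans (by nlinarith)
  have hI0 : 0 ≤ ∫ v in Set.Ioi (1:ℝ), ‖d v‖ := integral_nonneg fun _ => norm_nonneg _
  refine ⟨Gp R 1 + ∫ v in Set.Ioi (1:ℝ), d v, M + ∫ v in Set.Ioi (1:ℝ), ‖d v‖, ?_, ?_, ?_⟩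
  · have := (intervalIntegral_tendsto_integral_Ioi 1 hdi tendsto_id).const_add (Gp R 1)
    refine this.congr' ?_
    filter_upwards [eventually_ge_atTop 1] with T hT
    exact (key T hT).symm
  · intro T hT
    rw [key T hT]
    refine (abs_add_le _ _).trans (add_le_add (hG 1 zero_le_one le_rfl) ?_)
    rw [← Real.norm_eq_abs]
    refine (intervalIntegral.norm_integral_le_integral_norm hT).trans ?_
    rw [intervalIntegral.integral_of_le hT]
    exact setIntegral_mono_set hdi.norm (.of_forall fun _ => norm_nonneg _)
      (Set.Ioc_subset_Ioi_self.eventuallyLE)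
  · intro T hT hT1
    refine (abs_sub _ _).trans ?_
    rw [abs_mul, abs_of_pos (show 0 < (2 * π)⁻¹ by positivity)]
    linarith [hG T hT.le hT1]

theorem stmt_0 (R : (Fin 2 → ℝ) → ℝ) (hRcont : Continuous R) (hRnonneg : ∀ x, 0 ≤ R x)
    (hReven : ∀ x, R (-x) = R x) (hRsupp : HasCompactSupport R)
    (hRint : ∫ x : Fin 2 → ℝ, R x = 1) :
    ∃ μ₁ μ₂ : ℝ, ∀ t : ℝ, 0 < t →
      Tendsto (fun ε : ℝ => nuReg R ε t - (1 / π) * Real.log ε⁻¹ * t)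
        (nhdsWithin 0 (Set.Ioi 0)) (nhds (t * (μ₁ + μ₂ * Real.log t))) := by
  obtain ⟨c, A, hc, hA1, hA2⟩ := H_props R hRcont hRnonneg hRsupp hRint
  refine ⟨c - (2 * π)⁻¹, (2 * π)⁻¹, fun t ht => ?_⟩
  have hGc : Continuous (Gp R) :=
    intervalIntegral.continuous_primitive (gpos_ii R hRcont hRnonneg hRsupp) 0
  have hlim : ∫ s in (0:ℝ)..t, (c + (2 * π)⁻¹ * Real.log s) =
      t * (c - (2 * π)⁻¹ + (2 * π)⁻¹ * Real.log t) := by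
    rw [intervalIntegral.integral_add intervalIntegrable_const
      (intervalIntegral.intervalIntegrable_log'.const_mul _),
      intervalIntegral.integral_const_mul, integral_log, intervalIntegral.integral_const]
    simp only [smul_eq_mul]
    ring
  rw [← hlim]
  have heq : ∀ᶠ ε : ℝ in nhdsWithin 0 (Set.Ioi 0),
      (∫ s in (0:ℝ)..t, (Gp R ((ε ^ 2)⁻¹ * s) - (1 / π) * Real.log ε⁻¹)) =
      nuReg R ε t - (1 / π) * Real.log ε⁻¹ * t := by
    filter_upwards [self_mem_nhdsWithin] with ε hε
    have hci : Continuous (fun s : ℝ => Gp R ((ε ^ 2)⁻¹ * s)) := by fun_prop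
    rw [nu_eq R hε ht, intervalIntegral.integral_sub (hci.intervalIntegrable _ _)
      intervalIntegrable_const, intervalIntegral.integral_const]
    simp only [smul_eq_mul]
    ring
  refine Tendsto.congr' heq ?_
  have hsplit : ∀ ε s : ℝ, 0 < ε → 0 < s → Gp R ((ε ^ 2)⁻¹ * s) - (1 / π) * Real.log ε⁻¹ =
      (Gp R ((ε ^ 2)⁻¹ * s) - (2 * π)⁻¹ * Real.log ((ε ^ 2)⁻¹ * s)) + (2 * π)⁻¹ * Real.log s := by
    intro ε s hε hs
    rw [Real.log_mul (by positivity) hs.ne', Real.log_inv, Real.log_inv, Real.log_pow]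
    field_simp
    push_cast
    ring
  apply intervalIntegral.tendsto_integral_filter_of_dominated_convergence
    (fun s => A + (2 * π)⁻¹ * |Real.log s| + (2 * π)⁻¹ * |Real.log s|)
  · refine .of_forall fun ε => ?_
    exact ((hGc.comp (continuous_const.mul continuous_id)).sub continuous_const).aestronglyMeasurable
  · have h1 : Set.Ioo (0:ℝ) 1 ∈ nhdsWithin (0:ℝ) (Set.Ioi 0) := Ioo_mem_nhdsGT one_pos
    filter_upwards [h1] with ε hε
    refine .of_forall fun s hs => ?_
    rw [Set.uIoc_of_le ht.le] at hs
    have hs0 := hs.1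
    have hε0 := hε.1
    rw [hsplit ε s hε0 hs0, Real.norm_eq_abs]
    refine (abs_add_le _ _).trans ?_
    have hp : 0 < (2 * π)⁻¹ := by positivity
    rw [abs_mul (2 * π)⁻¹, abs_of_pos hp]
    gcongr
    have hT : 0 < (ε ^ 2)⁻¹ * s := by positivity
    rcases le_total 1 ((ε ^ 2)⁻¹ * s) with h | h
    · have := hA1 _ h
      have : 0 ≤ (2 * π)⁻¹ * |Real.log s| := by positivity
      linarith
    · refine (hA2 _ hT h).trans ?_
      refine add_le_add le_rfl (mul_le_mul_of_nonneg_left ?_ hp.le)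
      have hle : s ≤ (ε ^ 2)⁻¹ * s := by
        have : 1 ≤ (ε ^ 2)⁻¹ := (one_le_inv₀ (by positivity)).2 (by nlinarith [hε.2])
        nlinarith
      have l1 := Real.log_le_log hs0 hle
      have l2 := Real.log_nonpos hT.le h
      rw [abs_of_nonpos l2, abs_of_nonpos (l1.trans l2)]
      linarith
  · have hl : IntervalIntegrable (fun s => (2 * π)⁻¹ * |Real.log s|) volume 0 t :=
      (intervalIntegral.intervalIntegrable_log'.abs).const_mul _
    exact (intervalIntegrable_const.add hl).add hl
  · refine .of_forall fun s hs => ?_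
    rw [Set.uIoc_of_le ht.le] at hs
    have hs0 := hs.1
    have hT : Tendsto (fun ε : ℝ => (ε ^ 2)⁻¹ * s) (nhdsWithin 0 (Set.Ioi 0)) atTop := by
      apply Tendsto.atTop_mul_const hs0
      apply tendsto_inv_nhdsGT_zero.comp
      apply tendsto_nhdsWithin_iff.2 ⟨?_, ?_⟩
      · have : Tendsto (fun ε : ℝ => ε ^ 2) (nhds 0) (nhds (0 ^ 2)) := (continuous_pow 2).tendsto 0
        rw [zero_pow two_ne_zero] at this
        exact this.mono_left nhdsWithin_le_nhds
      · filter_upwards [self_mem_nhdsWithin] with ε hε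
        exact pow_pos (Set.mem_Ioi.1 hε) 2
    refine ((hc.comp hT).add_const ((2 * π)⁻¹ * Real.log s)).congr' ?_
    filter_upwards [self_mem_nhdsWithin] with ε hε
    exact (hsplit ε s hε hs0).symm
end

section
/- For every $t > 0$, $\lim_{\varepsilon \to 0^+} \Big[\nu_\varepsilon(t) - \frac{t}{\pi}\log \varepsilon^{-1}\Big] = \frac{t}{2\pi}\Big( \log(2t) - \gamma - 1 - \int_{\mathbb{R}^2} R(x) \log(|x|^2)\, dx \Big)$, where $\gamma$ is the Euler–Mascheroni constant. -/
open MeasureTheory ProbabilityTheory Real Filter Set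

noncomputable def E1 (z : ℝ) : ℝ :=
  -(Real.exp (-z) * Real.log z) - Real.eulerMascheroniConstant - ∫ w in (0:ℝ)..z, Real.exp (-w) * Real.log w

lemma ii_explog (a b : ℝ) : IntervalIntegrable (fun w : ℝ => Real.exp (-w) * Real.log w) volume a b := by
  apply IntervalIntegrable.continuousOn_mul
  · exact intervalIntegral.intervalIntegrable_log'
  · fun_prop

lemma integral_explog : ∫ w in Ioi (0:ℝ), Real.exp (-w) * Real.log w = -Real.eulerMascheroniConstant := by
  have h1 := Complex.hasDerivAt_GammaIntegral (s := 1) (by simp)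
  have h2 := Complex.hasDerivAt_Gamma_one
  have h3 : HasDerivAt Complex.GammaIntegral (-(Real.eulerMascheroniConstant : ℂ)) 1 := by
    refine h2.congr_of_eventuallyEq ?_
    have : ∀ᶠ s : ℂ in nhds 1, 0 < s.re :=
      (isOpen_lt continuous_const Complex.continuous_re).mem_nhds (by simp)
    filter_upwards [this] with s hs
    exact (Complex.Gamma_eq_integral hs).symm
  have h4 := h1.unique h3
  have h5 : (∫ t : ℝ in Ioi 0, (t:ℂ) ^ ((1:ℂ) - 1) * (Real.log t * Real.exp (-t) : ℂ)) =
      ((∫ w in Ioi (0:ℝ), Real.exp (-w) * Real.log w : ℝ) : ℂ) := by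
    rw [← integral_complex_ofReal]
    congr 1
    ext t
    simp [mul_comm]
  have h6 := h5.symm.trans h4
  exact_mod_cast h6

lemma integrable_explog : IntegrableOn (fun w : ℝ => Real.exp (-w) * Real.log w) (Ioi 0) := by
  by_contra h
  have := integral_undef h
  rw [integral_explog] at this
  linarith [Real.one_half_lt_eulerMascheroniConstant]

lemma E1_hasDerivAt {z : ℝ} (hz : 0 < z) : HasDerivAt E1 (-(Real.exp (-z) / z)) z := by
  have hc : ContinuousAt (fun w : ℝ => Real.exp (-w) * Real.log w) z := by
    have := Real.continuousAt_log hz.ne'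
    fun_prop
  have h1 := intervalIntegral.integral_hasDerivAt_right (ii_explog 0 z)
    (Measurable.stronglyMeasurable (by fun_prop)).stronglyMeasurableAtFilter hc
  have h2 : HasDerivAt (fun w : ℝ => Real.exp (-w)) (-Real.exp (-z)) z := by
    simpa using (hasDerivAt_neg z).exp
  have h3 := (((h2.mul (Real.hasDerivAt_log hz.ne')).neg).sub_const
    Real.eulerMascheroniConstant).sub h1
  refine h3.congr_deriv ?_
  field_simp
  ring

lemma E1_measurable : Measurable E1 := by
  have : Continuous fun z : ℝ => ∫ w in (0:ℝ)..z, Real.exp (-w) * Real.log w :=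
    intervalIntegral.continuous_primitive (fun a b => ii_explog a b) 0
  unfold E1
  have := this.measurable
  fun_prop

lemma E1_atTop : Tendsto E1 atTop (nhds 0) := by
  have h1 := intervalIntegral_tendsto_integral_Ioi (0:ℝ) integrable_explog tendsto_id
  rw [integral_explog] at h1
  have h2 : Tendsto (fun z : ℝ => Real.exp (-z) * Real.log z) atTop (nhds 0) := by
    refine squeeze_zero' (g := fun z : ℝ => z ^ 1 * Real.exp (-z)) ?_ ?_
      (Real.tendsto_pow_mul_exp_neg_atTop_nhds_zero 1)
    · filter_upwards [eventually_ge_atTop 1] with z hz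
      have := Real.log_nonneg hz
      positivity
    · filter_upwards [eventually_ge_atTop 1] with z hz
      have : Real.log z ≤ z := Real.log_le_self (by linarith)
      rw [pow_one, mul_comm]
      gcongr
  have h3 := (h2.neg.sub_const Real.eulerMascheroniConstant).sub h1
  have h4 : Tendsto E1 atTop (nhds (-0 - Real.eulerMascheroniConstant - -Real.eulerMascheroniConstant)) := h3
  simpa using h4

lemma E1_zero : Tendsto (fun z => E1 z + Real.log z) (nhdsWithin 0 (Ioi 0))
    (nhds (-Real.eulerMascheroniConstant)) := by
  have h1 : Tendsto (fun z : ℝ => ∫ w in (0:ℝ)..z, Real.exp (-w) * Real.log w)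
      (nhdsWithin 0 (Ioi 0)) (nhds 0) := by
    have : Continuous fun z : ℝ => ∫ w in (0:ℝ)..z, Real.exp (-w) * Real.log w :=
      intervalIntegral.continuous_primitive (fun a b => ii_explog a b) 0
    have := (this.tendsto 0).mono_left (nhdsWithin_le_nhds (s := Ioi 0))
    simpa using this
  have h2 : Tendsto (fun z : ℝ => (1 - Real.exp (-z)) * Real.log z)
      (nhdsWithin 0 (Ioi 0)) (nhds 0) := by
    have h3 : Tendsto (fun z : ℝ => |z * Real.log z|) (nhdsWithin 0 (Ioi 0)) (nhds 0) := by
      have := (Real.continuous_mul_log.abs.tendsto 0).mono_left (nhdsWithin_le_nhds (s := Ioi 0))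
      simpa using this
    refine squeeze_zero_norm' ?_ h3
    filter_upwards [self_mem_nhdsWithin] with z hz
    have hz : 0 < z := hz
    rw [Real.norm_eq_abs, abs_mul, abs_mul]
    refine mul_le_mul_of_nonneg_right ?_ (abs_nonneg _)
    rw [abs_of_pos hz, abs_le]
    have h4 := Real.add_one_le_exp (-z)
    have h5 : Real.exp (-z) ≤ 1 := Real.exp_le_one_iff.2 (by linarith)
    constructor <;> linarith
  have h3 := (h2.sub_const Real.eulerMascheroniConstant).sub h1
  simp only [zero_sub, sub_zero] at h3
  refine h3.congr ?_
  intro z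
  unfold E1
  ring

lemma gbound {a v : ℝ} (ha : 0 < a) (hv : 0 < v) :
    v⁻¹ * Real.exp (-(a / v)) ≤ (√a)⁻¹ * (√v)⁻¹ := by
  have h0 : 0 < a / v := by positivity
  have h1 : √(a / v) ≤ Real.exp (a / v) := by
    rw [Real.sqrt_le_left (Real.exp_pos _).le, ← Real.exp_nat_mul]
    have := Real.add_one_le_exp (((2:ℕ):ℝ) * (a/v))
    push_cast at this ⊢
    linarith
  rw [Real.exp_neg]
  have h2 : (Real.exp (a/v))⁻¹ ≤ (√(a/v))⁻¹ := by
    gcongr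
  calc _ ≤ v⁻¹ * (√(a/v))⁻¹ := by gcongr
    _ = _ := by
      rw [Real.sqrt_div ha.le, inv_div]
      have : v = √v * √v := (Real.mul_self_sqrt hv.le).symm
      have h : 0 < √v := by positivity
      have h' : 0 < √a := by positivity
      nth_rw 1 [this]
      field_simp

lemma sqrt_deriv {v : ℝ} (hv : 0 < v) : HasDerivAt (fun v => 2 * √v) (√v)⁻¹ v := by
  refine ((Real.hasDerivAt_sqrt hv.ne').const_mul 2).congr_deriv ?_
  have : 0 < √v := by positivity
  field_simp

lemma ii_sqrt_inv {s : ℝ} (hs : 0 < s) :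
    IntervalIntegrable (fun v : ℝ => (√v)⁻¹) volume 0 s := by
  rw [intervalIntegrable_iff_integrableOn_Ioc_of_le hs.le]
  refine intervalIntegral.integrableOn_deriv_of_nonneg (g := fun v => 2 * √v)
    (by fun_prop) (fun v hv => sqrt_deriv hv.1) (fun v hv => by positivity)

lemma integral_sqrt_inv {s : ℝ} (hs : 0 < s) : ∫ v in (0:ℝ)..s, (√v)⁻¹ = 2 * √s := by
  have := intervalIntegral.integral_eq_sub_of_hasDerivAt_of_le hs.le
    (f := fun v => 2 * √v) (by fun_prop) (fun v hv => sqrt_deriv hv.1) (ii_sqrt_inv hs)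
  simpa using this

lemma g_ii {a s : ℝ} (ha : 0 < a) (hs : 0 < s) :
    IntervalIntegrable (fun v : ℝ => v⁻¹ * Real.exp (-(a / v))) volume 0 s := by
  refine ((ii_sqrt_inv hs).const_mul (√a)⁻¹).mono_fun'
    (Measurable.aestronglyMeasurable (by fun_prop)) ?_
  rw [uIoc_of_le hs.le]
  refine (ae_restrict_iff' measurableSet_Ioc).2 (ae_of_all _ ?_)
  intro v hv
  have : 0 < v := hv.1
  beta_reduce
  rw [Real.norm_of_nonneg (by positivity)]
  exact gbound ha hv.1

lemma tendsto_div_zero {a : ℝ} (ha : 0 < a) :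
    Tendsto (fun v : ℝ => a / v) (nhdsWithin 0 (Ioi 0)) atTop := by
  simp only [div_eq_mul_inv]
  exact tendsto_inv_nhdsGT_zero.const_mul_atTop ha

lemma E1_comp_deriv {a v : ℝ} (ha : 0 < a) (hv : 0 < v) :
    HasDerivAt (fun v => E1 (a / v)) (v⁻¹ * Real.exp (-(a / v))) v := by
  have h1 : HasDerivAt (fun v : ℝ => a / v) (-(a / v^2)) v := by
    simpa [div_eq_mul_inv] using (hasDerivAt_inv hv.ne').const_mul a
  have := (E1_hasDerivAt (div_pos ha hv)).comp v h1
  refine this.congr_deriv ?_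
  field_simp

lemma g_integral {a s : ℝ} (ha : 0 < a) (hs : 0 < s) :
    ∫ v in (0:ℝ)..s, v⁻¹ * Real.exp (-(a / v)) = E1 (a / s) := by
  have := intervalIntegral.integral_eq_sub_of_hasDerivAt_of_tendsto hs (fa := 0) (fb := E1 (a/s))
    (fun v hv => E1_comp_deriv ha hv.1) (g_ii ha hs) (E1_atTop.comp (tendsto_div_zero ha))
    ((E1_comp_deriv ha hs).continuousAt.tendsto.mono_left nhdsWithin_le_nhds)
  simpa using this

lemma E1_bound {a s : ℝ} (ha : 0 < a) (hs : 0 < s) : |E1 (a / s)| ≤ (√a)⁻¹ * (2 * √s) := by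
  rw [← g_integral ha hs, ← integral_sqrt_inv hs, ← intervalIntegral.integral_const_mul,
    ← Real.norm_eq_abs]
  refine intervalIntegral.norm_integral_le_of_norm_le hs.le ?_ ((ii_sqrt_inv hs).const_mul (√a)⁻¹)
  refine ae_of_all _ fun v hv => ?_
  have : 0 < v := hv.1
  beta_reduce
  rw [Real.norm_of_nonneg (by positivity)]
  exact gbound ha hv.1

noncomputable def KK (t a : ℝ) : ℝ := ∫ v in (0:ℝ)..t, Real.exp (-(a / v))

lemma e_ii {a s : ℝ} (ha : 0 ≤ a) (hs : 0 ≤ s) :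
    IntervalIntegrable (fun v : ℝ => Real.exp (-(a / v))) volume 0 s := by
  refine (intervalIntegrable_const (c := (1:ℝ))).mono_fun'
    (Measurable.aestronglyMeasurable (by fun_prop)) ?_
  rw [uIoc_of_le hs]
  refine (ae_restrict_iff' measurableSet_Ioc).2 (ae_of_all _ ?_)
  intro v hv
  have : 0 < v := hv.1
  beta_reduce
  rw [Real.norm_of_nonneg (by positivity), Real.exp_le_one_iff]
  have : 0 ≤ a / v := by positivity
  linarith

lemma E1_ii {a s : ℝ} (ha : 0 < a) (hs : 0 < s) :
    IntervalIntegrable (fun v : ℝ => E1 (a / v)) volume 0 s := by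
  refine ((Real.continuous_sqrt.const_mul 2).const_mul (√a)⁻¹ |>.intervalIntegrable 0 s).mono_fun'
    (Measurable.aestronglyMeasurable (by have := E1_measurable; fun_prop)) ?_
  rw [uIoc_of_le hs.le]
  refine (ae_restrict_iff' measurableSet_Ioc).2 (ae_of_all _ ?_)
  intro v hv
  exact E1_bound ha hv.1

lemma KK_deriv {a s : ℝ} (ha : 0 < a) (hs : 0 < s) :
    HasDerivAt (fun s => KK s a) (Real.exp (-(a / s))) s := by
  unfold KK
  refine intervalIntegral.integral_hasDerivAt_right (e_ii ha.le hs.le)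
    (Measurable.stronglyMeasurable (by fun_prop)).stronglyMeasurableAtFilter ?_
  have := hs.ne'
  fun_prop (disch := assumption)

lemma KK_le {a s : ℝ} (ha : 0 < a) (hs : 0 < s) : |KK s a| ≤ s := by
  unfold KK
  have := intervalIntegral.norm_integral_le_of_norm_le_const (a := 0) (b := s) (C := 1)
    (f := fun v : ℝ => Real.exp (-(a / v))) ?_
  · simpa [abs_of_pos hs] using this
  · intro v hv
    rw [uIoc_of_le hs.le] at hv
    have : 0 < v := hv.1
    rw [Real.norm_of_nonneg (by positivity), Real.exp_le_one_iff]
    have : 0 ≤ a / v := by positivity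
    linarith

lemma E1_integral {a t : ℝ} (ha : 0 < a) (ht : 0 < t) :
    ∫ s in (0:ℝ)..t, E1 (a / s) = t * E1 (a / t) - KK t a := by
  have hd : ∀ s, 0 < s → HasDerivAt (fun s => s * E1 (a / s) - KK s a) (E1 (a / s)) s := by
    intro s hs
    refine (((hasDerivAt_id s).mul (E1_comp_deriv ha hs)).sub (KK_deriv ha hs)).congr_deriv ?_
    simp; field_simp; ring
  have h0 : Tendsto (fun s : ℝ => s) (nhdsWithin 0 (Ioi 0)) (nhds 0) :=
    tendsto_id.mono_left nhdsWithin_le_nhds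
  have h1 : Tendsto (fun s => s * E1 (a / s) - KK s a) (nhdsWithin 0 (Ioi 0)) (nhds 0) := by
    have h2 : Tendsto (fun s => KK s a) (nhdsWithin 0 (Ioi 0)) (nhds 0) := by
      refine squeeze_zero_norm' ?_ h0
      filter_upwards [self_mem_nhdsWithin] with s hs
      exact KK_le ha hs
    simpa using (h0.mul (E1_atTop.comp (tendsto_div_zero ha))).sub h2
  have := intervalIntegral.integral_eq_sub_of_hasDerivAt_of_tendsto ht
    (fun v hv => hd v hv.1) (E1_ii ha ht) h1
    ((hd t ht).continuousAt.tendsto.mono_left nhdsWithin_le_nhds)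
  simpa using this

lemma KK_zero {t : ℝ} (ht : 0 < t) : Tendsto (KK t) (nhdsWithin 0 (Ioi 0)) (nhds t) := by
  have : t = ∫ v in (0:ℝ)..t, (1:ℝ) := by simp
  conv => arg 3; rw [this]
  unfold KK
  refine intervalIntegral.tendsto_integral_filter_of_dominated_convergence (fun _ => 1)
    (.of_forall fun a => Measurable.aestronglyMeasurable (by fun_prop)) ?_ (by simp) ?_
  · filter_upwards [self_mem_nhdsWithin] with a ha
    refine ae_of_all _ fun v hv => ?_
    rw [uIoc_of_le ht.le] at hv
    have h1 : 0 < v := hv.1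
    have h2 : 0 < a := ha
    rw [Real.norm_of_nonneg (by positivity), Real.exp_le_one_iff]
    have : 0 ≤ a / v := by positivity
    linarith
  · refine ae_of_all _ fun v hv => ?_
    have : Continuous fun a : ℝ => Real.exp (-(a / v)) := by fun_prop
    simpa using (this.tendsto 0).mono_left (nhdsWithin_le_nhds (s := Ioi 0))

lemma KK_measurable (t : ℝ) (ht : 0 < t) : Measurable (KK t) := by
  unfold KK
  simp only [intervalIntegral.integral_of_le ht.le]
  refine StronglyMeasurable.measurable ?_
  refine StronglyMeasurable.integral_prod_right (f := fun a v : ℝ => Real.exp (-(a / v))) ?_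
  refine Measurable.stronglyMeasurable ?_
  unfold Function.uncurry
  fun_prop

noncomputable def qq (y : Fin 2 → ℝ) : ℝ := y 0 ^ 2 + y 1 ^ 2

lemma qq_cont : Continuous qq := by unfold qq; fun_prop

lemma qq_pos {y : Fin 2 → ℝ} (hy : y ≠ 0) : 0 < qq y := by
  unfold qq
  by_contra h
  have h0 : y 0 = 0 := by nlinarith [sq_nonneg (y 0), sq_nonneg (y 1)]
  have h1 : y 1 = 0 := by nlinarith [sq_nonneg (y 0), sq_nonneg (y 1)]
  apply hy
  ext i
  fin_cases i <;> simp [h0, h1]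

lemma qq_pos_ae : ∀ᵐ y : Fin 2 → ℝ, 0 < qq y := by
  have : ∀ᵐ y : Fin 2 → ℝ, y ≠ 0 := Measure.ae_ne volume 0
  filter_upwards [this] with y hy using qq_pos hy

lemma norm_le_qq (y : Fin 2 → ℝ) : ‖y‖ ≤ √(qq y) := by
  rw [pi_norm_le_iff_of_nonneg (by positivity)]
  intro i
  rw [Real.norm_eq_abs]
  apply Real.abs_le_sqrt
  unfold qq
  fin_cases i <;> simp <;> positivity

lemma int_Rsqrt {R : (Fin 2 → ℝ) → ℝ} (hc : Continuous R) (hs : HasCompactSupport R) :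
    Integrable (fun y => R y * (√(qq y))⁻¹) := by
  obtain ⟨M, hM⟩ := hs.exists_bound_of_continuous hc
  obtain ⟨b, hb⟩ := hs.isCompact.isBounded.exists_norm_le
  have h1 : Integrable (fun y : Fin 2 → ℝ => (indicator (Iic b) (fun r : ℝ => M * r⁻¹)) ‖y‖) := by
    rw [integrable_fun_norm_addHaar (μ := volume) (E := Fin 2 → ℝ)
      (f := indicator (Iic b) (fun r : ℝ => M * r⁻¹))]
    have h2 : IntegrableOn (fun y : ℝ => indicator (Iic b) (fun _ => M) y) (Ioi 0) := by
      rw [IntegrableOn, integrable_indicator_iff measurableSet_Iic, IntegrableOn,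
        Measure.restrict_restrict measurableSet_Iic]
      have : Iic b ∩ Ioi 0 = Ioc 0 b := by ext; simp [and_comm]
      rw [this]
      exact integrableOn_const (by simp)
    refine h2.congr_fun ?_ measurableSet_Ioi
    intro r hr
    have hr : 0 < r := hr
    by_cases h : r ≤ b
    · simp [h]; field_simp
    · simp [h]
  refine h1.mono' (Measurable.aestronglyMeasurable ?_) ?_
  · have := hc.measurable
    have := qq_cont.measurable
    fun_prop
  · filter_upwards [Measure.ae_ne volume (0 : Fin 2 → ℝ)] with y hy
    by_cases h : R y = 0
    · simp only [h, zero_mul, norm_zero]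
      have hM0 : 0 ≤ M := (norm_nonneg _).trans (hM 0)
      rw [indicator_apply]
      split_ifs <;> positivity
    · have hyb : ‖y‖ ≤ b := hb y (subset_tsupport _ h)
      rw [indicator_of_mem (by exact hyb), norm_mul]
      have hn : 0 < ‖y‖ := norm_pos_iff.2 hy
      have h3 : (√(qq y))⁻¹ ≤ ‖y‖⁻¹ := by gcongr; exact norm_le_qq y
      rw [Real.norm_of_nonneg (r := (√(qq y))⁻¹) (by positivity)]
      have := hM y
      have : 0 ≤ M := (norm_nonneg _).trans this
      gcongr

lemma int_Rlog {R : (Fin 2 → ℝ) → ℝ} (hc : Continuous R) (hs : HasCompactSupport R) :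
    Integrable (fun y => R y * Real.log (qq y)) := by
  have h1 : Integrable (fun y => R y * qq y) :=
    (hc.mul qq_cont).integrable_of_hasCompactSupport hs.mul_right
  have h2 := h1.norm.add ((int_Rsqrt hc hs).norm.const_mul 2)
  refine h2.mono' (Measurable.aestronglyMeasurable ?_) ?_
  · have := hc.measurable
    have := qq_cont.measurable
    fun_prop
  · filter_upwards [qq_pos_ae] with y hy
    have h3 : Real.log (qq y) ≤ qq y := Real.log_le_self hy.le
    have h4 : -Real.log (qq y) ≤ 2 * (√(qq y))⁻¹ := by
      have := Real.log_le_self (x := (√(qq y))⁻¹) (by positivity)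
      rw [Real.log_inv, Real.log_sqrt hy.le] at this
      linarith
    have h5 : |Real.log (qq y)| ≤ qq y + 2 * (√(qq y))⁻¹ := by
      rw [abs_le]
      have : 0 < (√(qq y))⁻¹ := by positivity
      constructor <;> linarith
    simp only [Pi.add_apply, norm_mul]
    rw [Real.norm_of_nonneg hy.le, Real.norm_of_nonneg (r := (√(qq y))⁻¹) (by positivity),
      Real.norm_eq_abs (Real.log _)]
    calc _ ≤ ‖R y‖ * (qq y + 2 * (√(qq y))⁻¹) := by gcongr
      _ = _ := by ring

lemma swap_lemma {R : (Fin 2 → ℝ) → ℝ} (hc : Continuous R) (hs : HasCompactSupport R)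
    (h : ℝ → ℝ → ℝ) (hm : Measurable (Function.uncurry h)) (b : ℝ → ℝ) {s c : ℝ} (hs0 : 0 < s)
    (hc0 : 0 < c)
    (hb : IntervalIntegrable b volume 0 s)
    (hbd : ∀ a v, 0 < a → 0 < v → |h a v| ≤ (√a)⁻¹ * b v) :
    ∫ v in (0:ℝ)..s, ∫ y, R y * h (c * qq y) v = ∫ y, R y * ∫ v in (0:ℝ)..s, h (c * qq y) v := by
  simp only [intervalIntegral.integral_of_le hs0.le]
  rw [integral_integral_swap]
  · simp only [integral_const_mul]
  · rw [intervalIntegrable_iff_integrableOn_Ioc_of_le hs0.le] at hb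
    have h1 := Integrable.mul_prod hb ((int_Rsqrt hc hs).norm.const_mul (√c)⁻¹)
    refine h1.mono' (Measurable.aestronglyMeasurable ?_) ?_
    · have e1 : Measurable fun z : ℝ × (Fin 2 → ℝ) => h (c * qq z.2) z.1 :=
        hm.comp (f := fun z : ℝ × (Fin 2 → ℝ) => (c * qq z.2, z.1))
          (by have := qq_cont.measurable; fun_prop)
      have := hc.measurable
      exact (this.comp measurable_snd).mul e1
    · have e1 := Measure.quasiMeasurePreserving_snd (μ := volume.restrict (Ioc (0:ℝ) s))
        (ν := (volume : Measure (Fin 2 → ℝ))) |>.ae qq_pos_ae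
      have e2 := Measure.quasiMeasurePreserving_fst (μ := volume.restrict (Ioc (0:ℝ) s))
        (ν := (volume : Measure (Fin 2 → ℝ))) |>.ae (ae_restrict_mem measurableSet_Ioc)
      filter_upwards [e1, e2] with z hz1 hz2
      have := hbd (c * qq z.2) z.1 (by positivity) hz2.1
      rw [Real.sqrt_mul hc0.le] at this
      simp only [Function.uncurry, norm_mul]
      rw [Real.norm_eq_abs (h _ _), Real.norm_of_nonneg (r := (√(qq z.2))⁻¹) (by positivity)]
      calc _ ≤ ‖R z.2‖ * ((√c * √(qq z.2))⁻¹ * b z.1) := by gcongr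
        _ = _ := by rw [mul_inv]; ring

lemma inner_eq (R : (Fin 2 → ℝ) → ℝ) {ε : ℝ} (hε : 0 < ε) (v : ℝ) :
    ∫ x : Fin 2 → ℝ, mollify R ε x * heatKernel v x =
      (2 * π)⁻¹ * ∫ y, R y * (v⁻¹ * Real.exp (-((ε ^ 2 / 2 * qq y) / v))) := by
  have h1 := Measure.integral_comp_inv_smul_of_nonneg (μ := (volume : Measure (Fin 2 → ℝ)))
    (fun y => R y * (v⁻¹ * Real.exp (-((ε ^ 2 / 2 * qq y) / v)))) hε.le
  rw [Module.finrank_fin_fun, smul_eq_mul] at h1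
  have h2 : (∫ y, R y * (v⁻¹ * Real.exp (-((ε ^ 2 / 2 * qq y) / v)))) = (ε ^ 2)⁻¹ *
      ∫ x, R (ε⁻¹ • x) * (v⁻¹ * Real.exp (-((ε ^ 2 / 2 * qq (ε⁻¹ • x)) / v))) := by
    rw [h1]; field_simp
  rw [h2, ← integral_const_mul, ← integral_const_mul]
  congr 1
  ext x
  unfold mollify heatKernel
  have h3 : -((ε ^ 2 / 2 * qq (ε⁻¹ • x)) / v) = -(x 0 ^ 2 + x 1 ^ 2) / (2 * v) := by
    simp only [qq, Pi.smul_apply, smul_eq_mul]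
    rw [mul_pow, mul_pow, ← mul_add, inv_pow, neg_div]
    congr 1
    by_cases hv : v = 0
    · simp [hv]
    · field_simp
  rw [h3, mul_inv]
  ring

lemma nu_eq_s1 {R : (Fin 2 → ℝ) → ℝ} (hc : Continuous R) (hs : HasCompactSupport R)
    {ε t : ℝ} (hε : 0 < ε) (ht : 0 < t) :
    nuReg R ε t = (2 * π)⁻¹ * ∫ y, R y *
      (t * E1 ((ε ^ 2 / 2 * qq y) / t) - KK t (ε ^ 2 / 2 * qq y)) := by
  have hc0 : 0 < ε ^ 2 / 2 := by positivity
  have h1 : ∀ s, 0 < s → ∫ u in (0:ℝ)..s, ∫ x : Fin 2 → ℝ, mollify R ε x * heatKernel (s - u) x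
      = (2 * π)⁻¹ * ∫ y, R y * E1 ((ε ^ 2 / 2 * qq y) / s) := by
    intro s hs0
    rw [intervalIntegral.integral_comp_sub_left
      (fun v => ∫ x : Fin 2 → ℝ, mollify R ε x * heatKernel v x)]
    simp only [inner_eq R hε, sub_self, sub_zero, intervalIntegral.integral_const_mul]
    rw [swap_lemma hc hs (fun a v => v⁻¹ * Real.exp (-(a / v))) ?_ (fun v => (√v)⁻¹) hs0 hc0
      (ii_sqrt_inv hs0)]
    · congr 1
      refine integral_congr_ae ?_
      filter_upwards [qq_pos_ae] with y hy
      rw [g_integral (by positivity) hs0]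
    · intro a v ha hv
      rw [abs_of_nonneg (by positivity)]
      exact gbound ha hv
    · unfold Function.uncurry
      fun_prop
  unfold nuReg
  have h2 : ∫ s in (0:ℝ)..t, ∫ u in (0:ℝ)..s, ∫ x : Fin 2 → ℝ,
        mollify R ε x * heatKernel (s - u) x
      = ∫ s in (0:ℝ)..t, (2 * π)⁻¹ * ∫ y, R y * E1 ((ε ^ 2 / 2 * qq y) / s) := by
    refine intervalIntegral.integral_congr_ae (ae_of_all _ fun s hs => ?_)
    rw [uIoc_of_le ht.le] at hs
    exact h1 s hs.1
  rw [h2, intervalIntegral.integral_const_mul,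
    swap_lemma hc hs (fun a s => E1 (a / s)) ?_ (fun s => 2 * √s) ht hc0
      (Continuous.intervalIntegrable (by fun_prop) _ _)]
  · congr 1
    refine integral_congr_ae ?_
    filter_upwards [qq_pos_ae] with y hy
    rw [E1_integral (by positivity) ht]
  · intro a v ha hv
    exact E1_bound ha hv
  · have := E1_measurable
    unfold Function.uncurry
    fun_prop

noncomputable def Psi (t a : ℝ) : ℝ := t * (E1 (a / t) + Real.log (a / t)) - KK t a

lemma Psi_zero {t : ℝ} (ht : 0 < t) : Tendsto (Psi t) (nhdsWithin 0 (Ioi 0))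
    (nhds (t * (-Real.eulerMascheroniConstant) - t)) := by
  unfold Psi
  refine Tendsto.sub (Tendsto.const_mul _ (E1_zero.comp ?_)) (KK_zero ht)
  refine tendsto_nhdsWithin_iff.2 ⟨?_, ?_⟩
  · have : Continuous fun a : ℝ => a / t := by fun_prop
    simpa using (this.tendsto 0).mono_left (nhdsWithin_le_nhds (s := Ioi 0))
  · filter_upwards [self_mem_nhdsWithin] with a ha
    exact div_pos ha ht

lemma Psi_measurable {t : ℝ} (ht : 0 < t) : Measurable (Psi t) := by
  have := E1_measurable
  have := KK_measurable t ht
  unfold Psi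
  fun_prop

lemma arg_tendsto {q : ℝ} (hq : 0 < q) : Tendsto (fun ε : ℝ => ε ^ 2 / 2 * q)
    (nhdsWithin 0 (Ioi 0)) (nhdsWithin 0 (Ioi 0)) := by
  refine tendsto_nhdsWithin_iff.2 ⟨?_, ?_⟩
  · have : Continuous fun ε : ℝ => ε ^ 2 / 2 * q := by fun_prop
    simpa using (this.tendsto 0).mono_left (nhdsWithin_le_nhds (s := Ioi 0))
  · filter_upwards [self_mem_nhdsWithin] with a ha
    have : 0 < a := ha
    rw [mem_Ioi]
    positivity

lemma main_bound {R : (Fin 2 → ℝ) → ℝ} (hs : HasCompactSupport R) {t : ℝ} (ht : 0 < t) :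
    ∃ C : ℝ, ∀ᶠ ε : ℝ in nhdsWithin 0 (Ioi 0), ∀ y, 0 < qq y →
      ‖R y * Psi t (ε ^ 2 / 2 * qq y)‖ ≤ ‖R y‖ * C := by
  obtain ⟨B, hB⟩ := hs.isCompact.bddAbove_image (f := qq) qq_cont.continuousOn
  have h1 := (Psi_zero ht).norm.eventually (gt_mem_nhds (lt_add_one _))
  set C := ‖t * (-Real.eulerMascheroniConstant) - t‖ + 1
  refine ⟨C, ?_⟩
  rw [eventually_nhdsWithin_iff, Metric.eventually_nhds_iff] at h1
  obtain ⟨δ, hδ, h1⟩ := h1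
  have h2 : ∀ᶠ ε : ℝ in nhdsWithin 0 (Ioi 0), ε ^ 2 / 2 * (|B| + 1) < δ := by
    have := (arg_tendsto (q := |B| + 1) (by positivity)).mono_right nhdsWithin_le_nhds
    exact this.eventually (gt_mem_nhds hδ)
  filter_upwards [h2, self_mem_nhdsWithin] with ε h2 hε y hy
  have hε : 0 < ε := hε
  by_cases h : R y = 0
  · simp [h]
  have h3 : qq y ≤ B := hB (mem_image_of_mem _ (subset_tsupport _ h))
  rw [norm_mul]
  have h0 : 0 < ε ^ 2 / 2 * qq y := by positivity
  have h4 : ε ^ 2 / 2 * qq y < δ := by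
    refine lt_of_le_of_lt ?_ h2
    have := le_abs_self B
    gcongr
    linarith
  have := h1 (y := ε ^ 2 / 2 * qq y) (by rw [Real.dist_eq, sub_zero, abs_of_pos h0]; exact h4) h0
  gcongr

/-- For every `t > 0`,
`lim_{ε→0⁺} [ν_ε(t) - (t/π) log ε⁻¹]
  = (t/(2π)) (log(2t) - γ - 1 - ∫_{ℝ²} R(x) log(|x|²) dx)`,
where `γ` is the Euler–Mascheroni constant. -/
theorem stmt_1 (R : (Fin 2 → ℝ) → ℝ) (hRcont : Continuous R) (hRnonneg : ∀ x, 0 ≤ R x)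
    (hReven : ∀ x, R (-x) = R x) (hRsupp : HasCompactSupport R)
    (hRint : ∫ x : Fin 2 → ℝ, R x = 1) (t : ℝ) (ht : 0 < t) :
    Tendsto (fun ε : ℝ => nuReg R ε t - t / π * Real.log ε⁻¹)
      (nhdsWithin 0 (Set.Ioi 0))
      (nhds (t / (2 * π) * (Real.log (2 * t) - Real.eulerMascheroniConstant - 1
        - ∫ x : Fin 2 → ℝ, R x * Real.log (x 0 ^ 2 + x 1 ^ 2)))) := by
  obtain ⟨C, hC⟩ := main_bound hRsupp ht
  have hRi : Integrable R := hRcont.integrable_of_hasCompactSupport hRsupp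
  have hlog := int_Rlog hRcont hRsupp
  have hmeas : ∀ ε : ℝ, AEStronglyMeasurable (fun y => R y * Psi t (ε ^ 2 / 2 * qq y)) volume := by
    intro ε
    have := hRcont.measurable
    have := qq_cont.measurable
    have := Psi_measurable ht
    exact Measurable.aestronglyMeasurable (by fun_prop)
  have hlim : Tendsto (fun ε : ℝ => ∫ y, R y * Psi t (ε ^ 2 / 2 * qq y)) (nhdsWithin 0 (Ioi 0))
      (nhds (∫ y, R y * (t * (-Real.eulerMascheroniConstant) - t))) := by
    refine tendsto_integral_filter_of_dominated_convergence (fun y => ‖R y‖ * C)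
      (.of_forall hmeas) ?_ (hRi.norm.mul_const C) ?_
    · filter_upwards [hC] with ε h
      filter_upwards [qq_pos_ae] with y hy using h y hy
    · filter_upwards [qq_pos_ae] with y hy
      exact ((Psi_zero ht).comp (arg_tendsto hy)).const_mul (R y)
  rw [integral_mul_const, hRint, one_mul] at hlim
  have hfin := (hlim.add_const (t * Real.log (2 * t) - t * ∫ y, R y * Real.log (qq y))).const_mul
    (2 * π)⁻¹
  have hval : t / (2 * π) * (Real.log (2 * t) - Real.eulerMascheroniConstant - 1
        - ∫ x : Fin 2 → ℝ, R x * Real.log (x 0 ^ 2 + x 1 ^ 2)) =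
      (2 * π)⁻¹ * (t * (-Real.eulerMascheroniConstant) - t +
        (t * Real.log (2 * t) - t * ∫ y, R y * Real.log (qq y))) := by
    unfold qq
    ring
  rw [hval]
  refine hfin.congr' ?_
  filter_upwards [hC, self_mem_nhdsWithin] with ε hε' hε
  have hε : 0 < ε := hε
  have hPi : Integrable (fun y => R y * Psi t (ε ^ 2 / 2 * qq y)) := by
    refine (hRi.norm.mul_const C).mono' (hmeas ε) ?_
    filter_upwards [qq_pos_ae] with y hy using hε' y hy
  rw [nu_eq_s1 hRcont hRsupp hε ht]
  have key : (∫ y, R y * (t * E1 ((ε ^ 2 / 2 * qq y) / t) - KK t (ε ^ 2 / 2 * qq y))) =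
      (∫ y, R y * Psi t (ε ^ 2 / 2 * qq y)) +
        ((t * Real.log (2 * t) + 2 * t * Real.log ε⁻¹) * (∫ y, R y)
          - t * ∫ y, R y * Real.log (qq y)) := by
    rw [← integral_const_mul, ← integral_const_mul,
      ← integral_sub (hRi.const_mul _) (hlog.const_mul _), ← integral_add hPi ?_]
    swap
    · exact (hRi.const_mul _).sub (hlog.const_mul _)
    refine integral_congr_ae ?_
    filter_upwards [qq_pos_ae] with y hy
    have e : Real.log (ε ^ 2 / 2 * qq y / t) =
        -2 * Real.log ε⁻¹ + Real.log (qq y) - Real.log (2 * t) := by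
      have : ε ^ 2 / 2 * qq y / t = ε ^ 2 * qq y / (2 * t) := by field_simp
      rw [this, Real.log_div (by positivity) (by positivity),
        Real.log_mul (by positivity) (by positivity), Real.log_pow, Real.log_inv]
      push_cast
      ring
    simp only [Psi, e]
    ring
  rw [key, hRint]
  have := Real.pi_pos
  field_simp
  ring
end
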